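/- arXiv:2108.01611 — 2 statements merged into one kernel-verified Lean document; each statement's English description precedes it below -/
import Mathlib

section
/- Let K = (K_n)_{n≥1} be a matrix convex set in V with 0 ∈ K₁ and K₁ containing a nonzero point. Then every matrix exposed point A ∈ K_n of K is an exposed point of the convex set K_n ⊆ M_n(V). -/
open scoped Matrix Kronecker ComplexOrder

noncomputable section

variable {V : Type*} [AddCommGroup V] [Module ℂ V]

/-- The matrix `γ* A γ` computed entrywise via the `ℂ`-action on `V`. -/
def mconj {m n : ℕ} (γ : Matrix (Fin m) (Fin n) ℂ)
    (A : Matrix (Fin m) (Fin m) V) : Matrix (Fin n) (Fin n) V :=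
  Matrix.of fun i j => ∑ k, ∑ l, (star (γ k i) * γ l j) • A k l

/-- A graded family `K = (K_n)` is a matrix convex set. -/
def IsMatrixConvex (K : ∀ n : ℕ, Set (Matrix (Fin n) (Fin n) V)) : Prop :=
  ∀ (k n : ℕ), 0 < k → 0 < n →
    ∀ (ns : Fin k → ℕ) (A : ∀ i : Fin k, Matrix (Fin (ns i)) (Fin (ns i)) V)
      (γ : ∀ i : Fin k, Matrix (Fin (ns i)) (Fin n) ℂ),
      (∀ i, 0 < ns i) → (∀ i, A i ∈ K (ns i)) →
      (∑ i, (γ i)ᴴ * γ i) = 1 →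
      (∑ i, mconj (γ i) (A i)) ∈ K n

/-- The `r`-th ampliation of `Φ : V → M_m(ℂ)` applied to `B ∈ M_r(V)`, as a matrix
indexed by `Fin m × Fin r` (block `(i,j)`, inner indices `(p,q)` ↦ `Φ (B i j) p q`). -/
def amplify {m r : ℕ} (Φ : V → Matrix (Fin m) (Fin m) ℂ)
    (B : Matrix (Fin r) (Fin r) V) : Matrix (Fin m × Fin r) (Fin m × Fin r) ℂ :=
  Matrix.of fun p q => Φ (B p.2 q.2) p.1 q.1

/-- Hermitian part `(X + X*)/2` of a complex matrix. -/
def reM {ι : Type*} (X : Matrix ι ι ℂ) : Matrix ι ι ℂ := (2 : ℂ)⁻¹ • (X + Xᴴ)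

section Top

variable [TopologicalSpace V]

/-- `(Φ, α)` matricially exposes the point `A ∈ K_n`. -/
def IsExposingPair (K : ∀ n : ℕ, Set (Matrix (Fin n) (Fin n) V)) {n : ℕ}
    (A : Matrix (Fin n) (Fin n) V)
    (Φ : V →L[ℂ] Matrix (Fin n) (Fin n) ℂ) (α : Matrix (Fin n) (Fin n) ℂ) : Prop :=
  α.IsHermitian ∧
  (∀ r : ℕ, 0 < r → ∀ B ∈ K r,
    (α ⊗ₖ (1 : Matrix (Fin r) (Fin r) ℂ) - reM (amplify (⇑Φ) B)).PosSemidef) ∧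
  {B | B ∈ K n ∧
      (α ⊗ₖ (1 : Matrix (Fin n) (Fin n) ℂ) - reM (amplify (⇑Φ) B)).PosSemidef ∧
      ¬ IsUnit (α ⊗ₖ (1 : Matrix (Fin n) (Fin n) ℂ) - reM (amplify (⇑Φ) B))} =
    {B | ∃ U ∈ Matrix.unitaryGroup (Fin n) ℂ, B = mconj U A}

/-- `A ∈ K_n` is a matrix exposed point of `K`. -/
def IsMatrixExposed (K : ∀ n : ℕ, Set (Matrix (Fin n) (Fin n) V)) {n : ℕ}
    (A : Matrix (Fin n) (Fin n) V) : Prop :=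
  ∃ (Φ : V →L[ℂ] Matrix (Fin n) (Fin n) ℂ) (α : Matrix (Fin n) (Fin n) ℂ),
    IsExposingPair K A Φ α

end Top

/-- Classical exposed point of a set in a topological `ℂ`-vector space. -/
def IsExposedPoint {W : Type*} [AddCommGroup W] [Module ℂ W] [TopologicalSpace W]
    (C : Set W) (x : W) : Prop :=
  x ∈ C ∧ ∃ (φ : W →L[ℂ] ℂ) (a : ℝ),
    (φ x).re = a ∧ ∀ y ∈ C, y ≠ x → (φ y).re < a

/-- Classical exposed face of a set in a topological `ℂ`-vector space. -/
def IsExposedFaceOf {W : Type*} [AddCommGroup W] [Module ℂ W] [TopologicalSpace W]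
    (C F : Set W) : Prop :=
  F ⊆ C ∧ ∃ (φ : W →L[ℂ] ℂ) (a : ℝ),
    (∀ x ∈ F, (φ x).re = a) ∧ ∀ y ∈ C, y ∉ F → (φ y).re < a

/-- `A ∈ K_n` is a matrix extreme point of the graded family `K`. -/
def IsMatrixExtreme (K : ∀ n : ℕ, Set (Matrix (Fin n) (Fin n) V)) {n : ℕ}
    (A : Matrix (Fin n) (Fin n) V) : Prop :=
  A ∈ K n ∧
  ∀ (k : ℕ), 0 < k →
    ∀ (ns : Fin k → ℕ) (Ai : ∀ i : Fin k, Matrix (Fin (ns i)) (Fin (ns i)) V)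
      (γ : ∀ i : Fin k, Matrix (Fin (ns i)) (Fin n) ℂ),
      (∀ i, 0 < ns i) → (∀ i, Ai i ∈ K (ns i)) →
      (∀ i, Function.Surjective (γ i).mulVec) →
      (∑ i, (γ i)ᴴ * γ i) = 1 →
      (∑ i, mconj (γ i) (Ai i)) = A →
      ∀ i, ∃ (h : ns i = n) (U : Matrix (Fin n) (Fin n) ℂ),
        U ∈ Matrix.unitaryGroup (Fin n) ℂ ∧
        Matrix.reindex (finCongr h) (finCongr h) (Ai i) = mconj U A

/-- `Γ_n(K)`. -/
def GammaSet (K : ∀ n : ℕ, Set (Matrix (Fin n) (Fin n) V)) (n : ℕ) :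
    Set (Matrix (Fin n) (Fin n) ℂ × Matrix (Fin n) (Fin n) V) :=
  {P | ∃ (k : ℕ), 0 < k ∧ ∃ (A : Matrix (Fin k) (Fin k) V) (γ : Matrix (Fin k) (Fin n) ℂ),
    A ∈ K k ∧ (γᴴ * γ).trace = 1 ∧ P = (γᴴ * γ, mconj γ A)}

/-- Matrix face `F ⊆ K_n`. -/
def IsMatrixFace (K : ∀ n : ℕ, Set (Matrix (Fin n) (Fin n) V)) {n : ℕ}
    (F : Set (Matrix (Fin n) (Fin n) V)) : Prop :=
  F ⊆ K n ∧ Convex ℝ F ∧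
  ∀ (k : ℕ), 0 < k →
    ∀ (ns : Fin k → ℕ) (Ai : ∀ i : Fin k, Matrix (Fin (ns i)) (Fin (ns i)) V)
      (γ : ∀ i : Fin k, Matrix (Fin (ns i)) (Fin n) ℂ),
      (∀ i, 0 < ns i) → (∀ i, Ai i ∈ K (ns i)) →
      (∀ i, Function.Surjective (γ i).mulVec) →
      (∑ i, (γ i)ᴴ * γ i) = 1 →
      (∑ i, mconj (γ i) (Ai i)) ∈ F →
      ∀ i, ∃ h : ns i = n, Matrix.reindex (finCongr h) (finCongr h) (Ai i) ∈ F

/-- `A` is a `C*`-extreme point of `F ⊆ M_n(V)`. -/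
def IsCStarExtreme {n : ℕ} (F : Set (Matrix (Fin n) (Fin n) V))
    (A : Matrix (Fin n) (Fin n) V) : Prop :=
  A ∈ F ∧
  ∀ (k : ℕ), 0 < k →
    ∀ (Ai : Fin k → Matrix (Fin n) (Fin n) V) (γ : Fin k → Matrix (Fin n) (Fin n) ℂ),
      (∀ i, Ai i ∈ F) → (∀ i, IsUnit (γ i)) →
      (∑ i, (γ i)ᴴ * γ i) = 1 →
      (∑ i, mconj (γ i) (Ai i)) = A →
      ∀ i, ∃ U ∈ Matrix.unitaryGroup (Fin n) ℂ, Ai i = mconj U A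

section Top2

variable [TopologicalSpace V]

/-- `(Φ, α)` is an exposing pair for the face `F ⊆ K_n`. -/
def IsFaceExposingPair (K : ∀ n : ℕ, Set (Matrix (Fin n) (Fin n) V)) {n : ℕ}
    (F : Set (Matrix (Fin n) (Fin n) V))
    (Φ : V →L[ℂ] Matrix (Fin n) (Fin n) ℂ) (α : Matrix (Fin n) (Fin n) ℂ) : Prop :=
  α.IsHermitian ∧
  (∀ m : ℕ, 0 < m → ∀ B ∈ K m,
    (α ⊗ₖ (1 : Matrix (Fin m) (Fin m) ℂ) - reM (amplify (⇑Φ) B)).PosSemidef) ∧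
  (∀ m : ℕ, 0 < m → m < n → ∀ B ∈ K m,
    (α ⊗ₖ (1 : Matrix (Fin m) (Fin m) ℂ) - reM (amplify (⇑Φ) B)).PosDef) ∧
  {B | B ∈ K n ∧
      (α ⊗ₖ (1 : Matrix (Fin n) (Fin n) ℂ) - reM (amplify (⇑Φ) B)).PosSemidef ∧
      ¬ IsUnit (α ⊗ₖ (1 : Matrix (Fin n) (Fin n) ℂ) - reM (amplify (⇑Φ) B))} = F

/-- `F ⊆ K_n` is a matrix exposed face of `K`. -/
def IsMatrixExposedFace (K : ∀ n : ℕ, Set (Matrix (Fin n) (Fin n) V)) {n : ℕ}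
    (F : Set (Matrix (Fin n) (Fin n) V)) : Prop :=
  F ⊆ K n ∧ Convex ℝ F ∧
  ∃ (Φ : V →L[ℂ] Matrix (Fin n) (Fin n) ℂ) (α : Matrix (Fin n) (Fin n) ℂ),
    IsFaceExposingPair K F Φ α

/-- The unitary orbit of `F ⊆ M_n(V)`. -/
def unitaryOrbit {n : ℕ} (F : Set (Matrix (Fin n) (Fin n) V)) :
    Set (Matrix (Fin n) (Fin n) V) :=
  {B | ∃ A ∈ F, ∃ U ∈ Matrix.unitaryGroup (Fin n) ℂ, B = mconj U A}

/-- `F ⊆ K_n` is a weak matrix exposed face of `K`. -/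
def IsWeakMatrixExposedFace (K : ∀ n : ℕ, Set (Matrix (Fin n) (Fin n) V)) {n : ℕ}
    (F : Set (Matrix (Fin n) (Fin n) V)) : Prop :=
  F ⊆ K n ∧ Convex ℝ F ∧
  ∃ (Φ : V →L[ℂ] Matrix (Fin n) (Fin n) ℂ) (α : Matrix (Fin n) (Fin n) ℂ),
    α.IsHermitian ∧
    (∀ m : ℕ, 0 < m → ∀ B ∈ K m,
      (α ⊗ₖ (1 : Matrix (Fin m) (Fin m) ℂ) - reM (amplify (⇑Φ) B)).PosSemidef) ∧
    (∀ m : ℕ, 0 < m → m < n → ∀ B ∈ K m,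
      (α ⊗ₖ (1 : Matrix (Fin m) (Fin m) ℂ) - reM (amplify (⇑Φ) B)).PosDef) ∧
    {B | B ∈ K n ∧
        (α ⊗ₖ (1 : Matrix (Fin n) (Fin n) ℂ) - reM (amplify (⇑Φ) B)).PosSemidef ∧
        ¬ IsUnit (α ⊗ₖ (1 : Matrix (Fin n) (Fin n) ℂ) - reM (amplify (⇑Φ) B))} =
      unitaryOrbit F

end Top2

/-- `F = (F_n)` is a matrix multiface of `K`. -/
def IsMatrixMultiface (K F : ∀ n : ℕ, Set (Matrix (Fin n) (Fin n) V)) : Prop :=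
  (∀ n, F n ⊆ K n) ∧ (∀ n, Convex ℝ (F n)) ∧
  ∀ (k n : ℕ), 0 < k → 0 < n →
    ∀ (ns : Fin k → ℕ) (Ai : ∀ i : Fin k, Matrix (Fin (ns i)) (Fin (ns i)) V)
      (γ : ∀ i : Fin k, Matrix (Fin (ns i)) (Fin n) ℂ),
      (∀ i, 0 < ns i) → (∀ i, Ai i ∈ K (ns i)) →
      (∀ i, Function.Surjective (γ i).mulVec) →
      (∑ i, (γ i)ᴴ * γ i) = 1 →
      (∑ i, mconj (γ i) (Ai i)) ∈ F n →
      ∀ i, Ai i ∈ F (ns i)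

section Top3

variable [TopologicalSpace V]

/-- `F = (F_n)` is a matrix exposed multiface of `K`. -/
def IsMatrixExposedMultiface (K F : ∀ n : ℕ, Set (Matrix (Fin n) (Fin n) V)) : Prop :=
  (∀ n, F n ⊆ K n) ∧ (∀ n, Convex ℝ (F n)) ∧
  ∃ (r : ℕ), 0 < r ∧
    ∃ (Φ : V →L[ℂ] Matrix (Fin r) (Fin r) ℂ) (α : Matrix (Fin r) (Fin r) ℂ),
      α.IsHermitian ∧
      (∀ n : ℕ, 0 < n → ∀ B ∈ K n,
        (α ⊗ₖ (1 : Matrix (Fin n) (Fin n) ℂ) - reM (amplify (⇑Φ) B)).PosSemidef) ∧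
      (∀ n : ℕ, 0 < n →
        {B | B ∈ K n ∧
            (α ⊗ₖ (1 : Matrix (Fin n) (Fin n) ℂ) - reM (amplify (⇑Φ) B)).PosSemidef ∧
            ¬ IsUnit (α ⊗ₖ (1 : Matrix (Fin n) (Fin n) ℂ) - reM (amplify (⇑Φ) B))} = F n)

end Top3

end

section MatrixConvexity

variable {V : Type*} [AddCommGroup V] [Module ℂ V]

lemma IsMatrixConvex.mconj_add_mconj_mem {K : ∀ n : ℕ, Set (Matrix (Fin n) (Fin n) V)}
    (hK : IsMatrixConvex K) {m l n : ℕ} (hm : 0 < m) (hl : 0 < l) (hn : 0 < n)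
    {A : Matrix (Fin m) (Fin m) V} {B : Matrix (Fin l) (Fin l) V} (hA : A ∈ K m) (hB : B ∈ K l)
    {γ : Matrix (Fin m) (Fin n) ℂ} {δ : Matrix (Fin l) (Fin n) ℂ}
    (h : γᴴ * γ + δᴴ * δ = 1) : mconj γ A + mconj δ B ∈ K n := by
  let ns : Fin 2 → ℕ := ![m, l]
  let As : ∀ i : Fin 2, Matrix (Fin (ns i)) (Fin (ns i)) V :=
    Fin.cons (α := fun i => Matrix (Fin (ns i)) (Fin (ns i)) V) A
      (Fin.cons (α := fun i : Fin 1 => Matrix (Fin (ns i.succ)) (Fin (ns i.succ)) V) B finZeroElim)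
  let γs : ∀ i : Fin 2, Matrix (Fin (ns i)) (Fin n) ℂ :=
    Fin.cons (α := fun i => Matrix (Fin (ns i)) (Fin n) ℂ) γ
      (Fin.cons (α := fun i : Fin 1 => Matrix (Fin (ns i.succ)) (Fin n) ℂ) δ finZeroElim)
  have key := hK 2 n two_pos hn ns As γs
    (Fin.forall_fin_two.2 ⟨hm, hl⟩) (Fin.forall_fin_two.2 ⟨hA, hB⟩)
    ((Fin.sum_univ_two _).trans h)
  rw [Fin.sum_univ_two] at key
  exact key

lemma trace_mconj {m n : ℕ} (γ : Matrix (Fin m) (Fin n) ℂ) (A : Matrix (Fin m) (Fin m) V) :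
    (mconj γ A).trace = ∑ k, ∑ l, (γ * γᴴ) l k • A k l := by
  simp only [Matrix.trace, mconj, Matrix.diag_apply, Matrix.of_apply, Matrix.mul_apply,
    Matrix.conjTranspose_apply, Finset.sum_smul]
  rw [Finset.sum_comm]
  refine Finset.sum_congr rfl fun k _ => ?_
  rw [Finset.sum_comm]
  simp only [mul_comm]

lemma trace_mconj_unitary {n : ℕ} {U : Matrix (Fin n) (Fin n) ℂ}
    (hU : U ∈ Matrix.unitaryGroup (Fin n) ℂ) (A : Matrix (Fin n) (Fin n) V) :
    (mconj U A).trace = A.trace := by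
  have h : U * Uᴴ = 1 := Matrix.mem_unitaryGroup_iff.1 hU
  rw [trace_mconj, h]
  simp [Matrix.one_apply, Matrix.trace]

lemma mconj_zero {m n : ℕ} (γ : Matrix (Fin m) (Fin n) ℂ) :
    mconj γ (0 : Matrix (Fin m) (Fin m) V) = 0 := by
  ext i j
  simp [mconj]

lemma mconj_smul_one {n : ℕ} (hn : 0 < n) {c : ℂ}
    (hc : c • (1 : Matrix (Fin n) (Fin n) ℂ) ∈ Matrix.unitaryGroup (Fin n) ℂ)
    (A : Matrix (Fin n) (Fin n) V) : mconj (c • (1 : Matrix (Fin n) (Fin n) ℂ)) A = A := by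
  have h1 : star c * c = 1 := by
    have h := congrFun (congrFun (Matrix.mem_unitaryGroup_iff'.1 hc) ⟨0, hn⟩) ⟨0, hn⟩
    simpa [Matrix.star_eq_conjTranspose, Matrix.mul_apply, Matrix.one_apply, mul_comm] using h
  ext i j
  rw [mconj, Matrix.of_apply, Finset.sum_eq_single i, Finset.sum_eq_single j]
  · simp only [Complex.star_def] at h1
    simp [h1]
  · intro l _ hl
    simp [hl]
  · simp
  · intro k _ hk
    simp [Matrix.one_apply, hk]
  · simp

end MatrixConvexity

section Pencil

variable {V : Type*} [AddCommGroup V] [Module ℂ V] [TopologicalSpace V]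

lemma reM_add {ι : Type*} (X Y : Matrix ι ι ℂ) : reM (X + Y) = reM X + reM Y := by
  simp only [reM, Matrix.conjTranspose_add, ← smul_add]
  congr 1
  abel

lemma reM_conj {ι κ : Type*} [Fintype ι] (X : Matrix ι ι ℂ) (G : Matrix ι κ ℂ) :
    reM (Gᴴ * X * G) = Gᴴ * reM X * G := by
  simp [reM, Matrix.mul_add, Matrix.add_mul, Matrix.conjTranspose_mul, Matrix.mul_assoc]

lemma re_star_dotProduct_reM {ι : Type*} [Fintype ι] (X : Matrix ι ι ℂ) (ξ : ι → ℂ) :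
    (star ξ ⬝ᵥ reM X *ᵥ ξ).re = (star ξ ⬝ᵥ X *ᵥ ξ).re := by
  have h : star ξ ⬝ᵥ Xᴴ *ᵥ ξ = star (star ξ ⬝ᵥ X *ᵥ ξ) := by
    rw [Matrix.dotProduct_mulVec, ← Matrix.star_mulVec, Matrix.star_dotProduct]
  rw [reM, Matrix.smul_mulVec, Matrix.add_mulVec, dotProduct_smul, dotProduct_add, h]
  simp
  ring

/-- The Hermitian pencil `α ⊗ I - Re Φ_r(B)`. -/
noncomputable def pencil {m r : ℕ} (Φ : V →L[ℂ] Matrix (Fin m) (Fin m) ℂ) (α : Matrix (Fin m) (Fin m) ℂ)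
    (B : Matrix (Fin r) (Fin r) V) : Matrix (Fin m × Fin r) (Fin m × Fin r) ℂ :=
  α ⊗ₖ (1 : Matrix (Fin r) (Fin r) ℂ) - reM (amplify (⇑Φ) B)

lemma amplify_add {m r : ℕ} (Φ : V →L[ℂ] Matrix (Fin m) (Fin m) ℂ)
    (A B : Matrix (Fin r) (Fin r) V) :
    amplify (⇑Φ) (A + B) = amplify (⇑Φ) A + amplify (⇑Φ) B := by
  ext p q
  simp [amplify]

lemma amplify_mconj {m r n : ℕ} (Φ : V →L[ℂ] Matrix (Fin m) (Fin m) ℂ)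
    (γ : Matrix (Fin r) (Fin n) ℂ) (A : Matrix (Fin r) (Fin r) V) :
    amplify (⇑Φ) (mconj γ A) = ((1 : Matrix (Fin m) (Fin m) ℂ) ⊗ₖ γ)ᴴ * amplify (⇑Φ) A *
      ((1 : Matrix (Fin m) (Fin m) ℂ) ⊗ₖ γ) := by
  ext ⟨p, i⟩ ⟨q, j⟩
  simp only [amplify, mconj, Matrix.of_apply, map_sum, map_smul, Matrix.sum_apply,
    Matrix.smul_apply, Matrix.mul_apply, Fintype.sum_prod_type, Matrix.conjTranspose_apply,
    Matrix.kroneckerMap_apply, Matrix.one_apply, smul_eq_mul]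
  simp only [ite_mul, mul_ite, one_mul, zero_mul, mul_zero, apply_ite star, star_zero,
    Finset.sum_ite_irrel, Finset.sum_const_zero, Finset.sum_ite_eq',
    Finset.mem_univ, if_true, Finset.sum_mul]
  rw [Finset.sum_comm]
  refine Finset.sum_congr rfl fun l _ => Finset.sum_congr rfl fun k _ => ?_
  ring

lemma kronecker_conj {m r n : ℕ} (α : Matrix (Fin m) (Fin m) ℂ) (γ : Matrix (Fin r) (Fin n) ℂ) :
    ((1 : Matrix (Fin m) (Fin m) ℂ) ⊗ₖ γ)ᴴ * α ⊗ₖ (1 : Matrix (Fin r) (Fin r) ℂ) *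
      ((1 : Matrix (Fin m) (Fin m) ℂ) ⊗ₖ γ) = α ⊗ₖ (γᴴ * γ) := by
  rw [Matrix.conjTranspose_kronecker, ← Matrix.mul_kronecker_mul, ← Matrix.mul_kronecker_mul]
  simp

lemma pencil_mconj {m r n : ℕ} (Φ : V →L[ℂ] Matrix (Fin m) (Fin m) ℂ)
    (α : Matrix (Fin m) (Fin m) ℂ) {γ : Matrix (Fin r) (Fin n) ℂ} (h : γᴴ * γ = 1)
    (A : Matrix (Fin r) (Fin r) V) :
    pencil Φ α (mconj γ A) = ((1 : Matrix (Fin m) (Fin m) ℂ) ⊗ₖ γ)ᴴ * pencil Φ α A *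
      ((1 : Matrix (Fin m) (Fin m) ℂ) ⊗ₖ γ) := by
  simp only [pencil]
  rw [amplify_mconj, reM_conj, Matrix.mul_sub, Matrix.sub_mul, kronecker_conj, h]

lemma pencil_mconj_add_mconj {m r s n : ℕ} (Φ : V →L[ℂ] Matrix (Fin m) (Fin m) ℂ)
    (α : Matrix (Fin m) (Fin m) ℂ) {γ : Matrix (Fin r) (Fin n) ℂ} {δ : Matrix (Fin s) (Fin n) ℂ}
    (h : γᴴ * γ + δᴴ * δ = 1) (A : Matrix (Fin r) (Fin r) V) (B : Matrix (Fin s) (Fin s) V) :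
    pencil Φ α (mconj γ A + mconj δ B) =
      ((1 : Matrix (Fin m) (Fin m) ℂ) ⊗ₖ γ)ᴴ * pencil Φ α A *
        ((1 : Matrix (Fin m) (Fin m) ℂ) ⊗ₖ γ) +
      ((1 : Matrix (Fin m) (Fin m) ℂ) ⊗ₖ δ)ᴴ * pencil Φ α B *
        ((1 : Matrix (Fin m) (Fin m) ℂ) ⊗ₖ δ) := by
  simp only [pencil]
  rw [amplify_add, reM_add, amplify_mconj, amplify_mconj, reM_conj, reM_conj, Matrix.mul_sub,
    Matrix.sub_mul, Matrix.mul_sub, Matrix.sub_mul, kronecker_conj, kronecker_conj, ← h,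
    Matrix.kronecker_add]
  abel

lemma not_isUnit_of_mulVec_eq_zero {ι : Type*} [Fintype ι] [DecidableEq ι] {M : Matrix ι ι ℂ}
    {ξ : ι → ℂ} (hξ : ξ ≠ 0) (h : M *ᵥ ξ = 0) : ¬ IsUnit M := by
  intro hM
  rw [Matrix.isUnit_iff_isUnit_det, isUnit_iff_ne_zero] at hM
  exact hM (Matrix.exists_mulVec_eq_zero_iff.1 ⟨ξ, hξ, h⟩)

/-- A singular square matrix is annihilated on the left by a unit row vector. -/
lemma exists_row_mul_eq_zero {n : ℕ} {X : Matrix (Fin n) (Fin n) ℂ} (hX : X.det = 0) :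
    ∃ δ : Matrix (Fin 1) (Fin n) ℂ, δ * δᴴ = 1 ∧ δ * X = 0 := by
  obtain ⟨v, hv, hvX⟩ := Matrix.exists_vecMul_eq_zero_iff.2 hX
  have hpos : 0 < ∑ i, ‖v i‖ ^ 2 := by
    obtain ⟨i, hi⟩ := Function.ne_iff.1 hv
    exact Finset.sum_pos' (fun _ _ => by positivity)
      ⟨i, Finset.mem_univ _, pow_pos (norm_pos_iff.2 hi) 2⟩
  set s := ∑ i, ‖v i‖ ^ 2 with hs
  have hvv : ∑ i, v i * star (v i) = (s : ℂ) := by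
    simp [hs, Complex.mul_conj, Complex.normSq_eq_norm_sq]
  have hsq : ((√s : ℝ) : ℂ) * (√s : ℝ) = s := by
    rw [← Complex.ofReal_mul, Real.mul_self_sqrt hpos.le]
  have hs0 : ((√s : ℝ) : ℂ) ≠ 0 := by
    exact_mod_cast (Real.sqrt_pos.2 hpos).ne'
  refine ⟨Matrix.of fun _ i => ((√s : ℝ) : ℂ)⁻¹ * v i, ?_, ?_⟩
  · ext i j
    have : ∀ x, ((√s : ℝ) : ℂ)⁻¹ * v x * star (((√s : ℝ) : ℂ)⁻¹ * v x) =
        (s : ℂ)⁻¹ * (v x * star (v x)) := by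
      intro x
      rw [← hsq]
      simp
      ring
    have hs1 : (s : ℂ) ≠ 0 := by exact_mod_cast hpos.ne'
    simp only [Matrix.mul_apply, Matrix.conjTranspose_apply, Matrix.of_apply, this,
      ← Finset.mul_sum, hvv, inv_mul_cancel₀ hs1]
    rw [Subsingleton.elim i j, Matrix.one_apply_eq]
  · ext i j
    have h := congrFun hvX j
    simp only [Matrix.vecMul, dotProduct, Pi.zero_apply] at h
    simp [Matrix.mul_apply, mul_assoc, ← Finset.mul_sum, h]

open Matrix in
/-- A nonzero kernel vector of the pencil at a matrix exposed point is an invertible matrix. -/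
lemma IsExposingPair.det_ne_zero {K : ∀ n : ℕ, Set (Matrix (Fin n) (Fin n) V)}
    (hK : IsMatrixConvex K) (h0 : (0 : Matrix (Fin 1) (Fin 1) V) ∈ K 1)
    (hnz : ∃ w ∈ K 1, w ≠ 0) {n : ℕ} (hn : 0 < n) {A : Matrix (Fin n) (Fin n) V} (hA : A ∈ K n)
    {Φ : V →L[ℂ] Matrix (Fin n) (Fin n) ℂ} {α : Matrix (Fin n) (Fin n) ℂ}
    (h : IsExposingPair K A Φ α) {X : Matrix (Fin n) (Fin n) ℂ} (hX0 : X ≠ 0)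
    (hX : pencil Φ α A *ᵥ vec X = 0) : X.det ≠ 0 := by
  intro hdet
  obtain ⟨δ, hδ, hδX⟩ := exists_row_mul_eq_zero hdet
  set P : Matrix (Fin n) (Fin n) ℂ := 1 - δᴴ * δ with hP
  have hPP : Pᴴ * P + δᴴ * δ = 1 := by
    have h1 : δᴴ * δ * (δᴴ * δ) = δᴴ * δ := by
      rw [Matrix.mul_assoc, ← Matrix.mul_assoc δ, hδ, Matrix.one_mul]
    have h2 : Pᴴ = P := by simp [hP, Matrix.conjTranspose_mul]
    rw [h2, hP, Matrix.mul_sub, Matrix.sub_mul, Matrix.sub_mul, h1]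
    simp
  have hPX : P * X = X := by
    rw [hP, Matrix.sub_mul, Matrix.mul_assoc, hδX]
    simp
  have htr : ∀ w ∈ K 1, (mconj P A + mconj δ w).trace = A.trace := by
    intro w hw
    have hmem := hK.mconj_add_mconj_mem hn one_pos hn hA hw hPP
    have hker : pencil Φ α (mconj P A + mconj δ w) *ᵥ vec X = 0 := by
      rw [pencil_mconj_add_mconj Φ α hPP, Matrix.add_mulVec, ← Matrix.mulVec_mulVec,
        ← Matrix.mulVec_mulVec, ← Matrix.mulVec_mulVec, ← Matrix.mulVec_mulVec,
        ← Matrix.vec_mul_eq_mulVec, ← Matrix.vec_mul_eq_mulVec, hPX, hδX, hX]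
      simp
    have hB : mconj P A + mconj δ w ∈ {B | ∃ U ∈ Matrix.unitaryGroup (Fin n) ℂ, B = mconj U A} :=
      h.2.2 ▸ ⟨hmem, h.2.1 n hn _ hmem,
        not_isUnit_of_mulVec_eq_zero (mt Matrix.vec_eq_zero_iff.1 hX0) hker⟩
    obtain ⟨U, hU, hBU⟩ := hB
    rw [hBU, trace_mconj_unitary hU]
  obtain ⟨w, hw, hw0⟩ := hnz
  have h1 := htr w hw
  rw [← htr 0 h0, Matrix.trace_add, Matrix.trace_add, add_right_inj, mconj_zero, trace_mconj,
    hδ] at h1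
  apply hw0
  ext i j
  simpa [Subsingleton.elim i 0, Subsingleton.elim j 0] using h1

/-- The continuous functional `B ↦ ⟨Φ_r(B) ξ, ξ⟩`. -/
noncomputable def amplifyForm {m r : ℕ} (Φ : V →L[ℂ] Matrix (Fin m) (Fin m) ℂ) (ξ : Fin m × Fin r → ℂ) :
    Matrix (Fin r) (Fin r) V →L[ℂ] ℂ where
  toFun B := star ξ ⬝ᵥ amplify (⇑Φ) B *ᵥ ξ
  map_add' A B := by rw [amplify_add, Matrix.add_mulVec, dotProduct_add]
  map_smul' c B := by
    have : amplify (⇑Φ) (c • B) = c • amplify (⇑Φ) B := by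
      ext p q
      simp [amplify]
    rw [this, Matrix.smul_mulVec, dotProduct_smul]
    rfl
  cont := by
    have hB : ∀ p q, Continuous fun B : Matrix (Fin r) (Fin r) V => amplify (⇑Φ) B p q :=
      fun p q => (Φ.continuous.comp (continuous_id.matrix_elem p.2 q.2)).matrix_elem p.1 q.1
    exact continuous_const.dotProduct ((continuous_matrix hB).matrix_mulVec continuous_const)

lemma exists_sub_smul_one_det_eq_zero {n : ℕ} (hn : 0 < n) (U : Matrix (Fin n) (Fin n) ℂ) :
    ∃ c : ℂ, (U - c • (1 : Matrix (Fin n) (Fin n) ℂ)).det = 0 := by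
  have : Nonempty (Fin n) := ⟨⟨0, hn⟩⟩
  obtain ⟨c, hc⟩ := spectrum.nonempty_of_isAlgClosed_of_finiteDimensional ℂ U
  refine ⟨c, ?_⟩
  rw [spectrum.mem_iff, IsUnit.sub_iff, Matrix.isUnit_iff_isUnit_det, isUnit_iff_ne_zero,
    not_not, Algebra.algebraMap_eq_smul_one] at hc
  exact hc

open Matrix in
lemma IsExposingPair.isExposedPoint {K : ∀ n : ℕ, Set (Matrix (Fin n) (Fin n) V)}
    (hK : IsMatrixConvex K) (h0 : (0 : Matrix (Fin 1) (Fin 1) V) ∈ K 1)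
    (hnz : ∃ w ∈ K 1, w ≠ 0) {n : ℕ} (hn : 0 < n) {A : Matrix (Fin n) (Fin n) V} (hA : A ∈ K n)
    {Φ : V →L[ℂ] Matrix (Fin n) (Fin n) ℂ} {α : Matrix (Fin n) (Fin n) ℂ}
    (h : IsExposingPair K A Φ α) : IsExposedPoint (K n) A := by
  have hAmem : A ∈ {B | ∃ U ∈ Matrix.unitaryGroup (Fin n) ℂ, B = mconj U A} := by
    have h1 : (1 : ℂ) • (1 : Matrix (Fin n) (Fin n) ℂ) ∈ Matrix.unitaryGroup (Fin n) ℂ := by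
      rw [one_smul]
      exact one_mem _
    exact ⟨_, h1, (mconj_smul_one hn h1 A).symm⟩
  rw [← h.2.2] at hAmem
  obtain ⟨ξ, hξ, hAξ⟩ : ∃ ξ ≠ 0, pencil Φ α A *ᵥ ξ = 0 := by
    rw [Matrix.exists_mulVec_eq_zero_iff]
    by_contra hdet
    exact hAmem.2.2 ((Matrix.isUnit_iff_isUnit_det _).2 (isUnit_iff_ne_zero.2 hdet))
  obtain ⟨X, rfl⟩ := Matrix.vec_bijective.surjective ξ
  have hX0 : X ≠ 0 := mt Matrix.vec_eq_zero_iff.2 hξ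
  have hpen : ∀ B : Matrix (Fin n) (Fin n) V, (star (vec X) ⬝ᵥ pencil Φ α B *ᵥ vec X).re =
      (star (vec X) ⬝ᵥ (α ⊗ₖ (1 : Matrix (Fin n) (Fin n) ℂ)) *ᵥ vec X).re -
        (amplifyForm Φ (vec X) B).re := by
    intro B
    rw [pencil, Matrix.sub_mulVec, dotProduct_sub, Complex.sub_re, re_star_dotProduct_reM]
    rfl
  refine ⟨hA, amplifyForm Φ (vec X), (amplifyForm Φ (vec X) A).re, rfl, fun B hB hBA => ?_⟩
  by_contra! hle
  have hpsd : (pencil Φ α B).PosSemidef := h.2.1 n hn B hB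
  have hnn := hpsd.dotProduct_mulVec_nonneg (vec X)
  have hA0 := hpen A
  rw [hAξ, dotProduct_zero, Complex.zero_re] at hA0
  have hre : (star (vec X) ⬝ᵥ pencil Φ α B *ᵥ vec X).re = 0 :=
    le_antisymm (by linarith [hpen B]) (Complex.le_def.1 hnn).1
  have hBX : pencil Φ α B *ᵥ vec X = 0 :=
    (hpsd.dotProduct_mulVec_zero_iff _).1
      (Complex.ext hre (Complex.le_def.1 hnn).2.symm)
  have hBmem : B ∈ {B | ∃ U ∈ Matrix.unitaryGroup (Fin n) ℂ, B = mconj U A} :=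
    h.2.2 ▸ ⟨hB, hpsd, not_isUnit_of_mulVec_eq_zero hξ hBX⟩
  obtain ⟨U, hU, rfl⟩ := hBmem
  have hUU : Uᴴ * U = 1 := Matrix.mem_unitaryGroup_iff'.1 hU
  have hUU' : U * Uᴴ = 1 := Matrix.mem_unitaryGroup_iff.1 hU
  have hUX : pencil Φ α A *ᵥ vec (U * X) = 0 := by
    have h2 := congrArg (((1 : Matrix (Fin n) (Fin n) ℂ) ⊗ₖ U) *ᵥ ·) hBX
    simp only [pencil_mconj Φ α hUU, Matrix.mulVec_mulVec, Matrix.mulVec_zero] at h2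
    rw [Matrix.conjTranspose_kronecker, ← Matrix.mul_assoc, ← Matrix.mul_assoc,
      ← Matrix.mul_kronecker_mul, hUU', Matrix.conjTranspose_one, Matrix.one_mul,
      Matrix.one_kronecker_one, Matrix.one_mul, ← Matrix.mulVec_mulVec,
      ← Matrix.vec_mul_eq_mulVec] at h2
    exact h2
  obtain ⟨c, hc⟩ := exists_sub_smul_one_det_eq_zero hn U
  have hdet := h.det_ne_zero hK h0 hnz hn hA hX0 hAξ
  have hcX : (U - c • (1 : Matrix (Fin n) (Fin n) ℂ)) * X = 0 := by
    by_contra hne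
    refine h.det_ne_zero hK h0 hnz hn hA hne ?_ (by rw [Matrix.det_mul, hc, zero_mul])
    rw [Matrix.sub_mul, Matrix.smul_mul, Matrix.one_mul, Matrix.vec_sub, Matrix.vec_smul,
      Matrix.mulVec_sub, Matrix.mulVec_smul, hUX, hAξ, smul_zero, sub_zero]
  have hUc : U = c • (1 : Matrix (Fin n) (Fin n) ℂ) := by
    have hXu : IsUnit X := (Matrix.isUnit_iff_isUnit_det X).2 (isUnit_iff_ne_zero.2 hdet)
    exact sub_eq_zero.1 (hXu.mul_left_eq_zero.1 hcX)
  subst hUc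
  exact hBA (mconj_smul_one hn hU A)

end Pencil

section Statements

variable {E F' : Type*} [AddCommGroup E] [Module ℂ E] [AddCommGroup F'] [Module ℂ F']
theorem matrixExposed_isExposedPoint
    (p : E →ₗ[ℂ] F' →ₗ[ℂ] ℂ)
    (K : ∀ n : ℕ, Set (Matrix (Fin n) (Fin n) (WeakBilin p)))
    (hK : IsMatrixConvex K)
    (h0 : (0 : Matrix (Fin 1) (Fin 1) (WeakBilin p)) ∈ K 1)
    (hnz : ∃ w ∈ K 1, w ≠ 0)
    (n : ℕ) (hn : 0 < n)
    (A : Matrix (Fin n) (Fin n) (WeakBilin p)) (hA : A ∈ K n)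
    (hAe : IsMatrixExposed K A) :
    IsExposedPoint (K n) A := by
  obtain ⟨Φ, α, h⟩ := hAe
  exact h.isExposedPoint hK h0 hnz hn hA

end Statements
end

section
/- Let K = (K_n)_{n≥1} be a matrix convex set in V with 0 ∈ K₁ and K₁ containing a nonzero point, let A ∈ K_r, and let γ be a surjective complex r × n matrix with tr(γ*γ) = 1. If the point (γ*γ, γ*Aγ) is an exposed point of the convex set Γ_n(K) ⊆ M_n(ℂ) × M_n(V), then A is a matrix exposed point of K. -/
open scoped Matrix Kronecker ComplexOrder

section MatrixConjugation

variable {V : Type*} [AddCommGroup V] [Module ℂ V]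

theorem mconj_mconj {k r n : ℕ} (γ : Matrix (Fin r) (Fin n) ℂ) (X : Matrix (Fin k) (Fin r) ℂ)
    (B : Matrix (Fin k) (Fin k) V) : mconj γ (mconj X B) = mconj (X * γ) B := by
  ext i j
  simp only [mconj, Matrix.of_apply, Matrix.mul_apply, star_sum, Finset.sum_mul_sum,
    Finset.smul_sum, Finset.sum_smul, smul_smul]
  have sum_swap : ∀ f : Fin r → Fin r → Fin k → Fin k → V,
      ∑ a, ∑ b, ∑ s, ∑ t, f a b s t = ∑ s, ∑ t, ∑ a, ∑ b, f a b s t := by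
    intro f
    have h := Finset.sum_comm (s := (Finset.univ : Finset (Fin r × Fin r)))
      (t := (Finset.univ : Finset (Fin k × Fin k))) (f := fun x y => f x.1 x.2 y.1 y.2)
    simpa only [Fintype.sum_prod_type] using h
  rw [sum_swap]
  refine Finset.sum_congr rfl fun s _ => Finset.sum_congr rfl fun t _ =>
    Finset.sum_congr rfl fun a _ => Finset.sum_congr rfl fun b _ => ?_
  congr 1
  simp only [star_mul']
  ring

theorem mconj_one {n : ℕ} (A : Matrix (Fin n) (Fin n) V) : mconj 1 A = A := by
  ext i j
  simp [mconj, Matrix.one_apply, ite_smul]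

theorem mconj_smul {m n : ℕ} (c : ℂ) (γ : Matrix (Fin m) (Fin n) ℂ)
    (A : Matrix (Fin m) (Fin m) V) : mconj (c • γ) A = (star c * c) • mconj γ A := by
  ext i j
  simp only [mconj, Matrix.of_apply, Matrix.smul_apply, smul_eq_mul, star_mul', Finset.smul_sum,
    smul_smul]
  refine Finset.sum_congr rfl fun k _ => Finset.sum_congr rfl fun l _ => ?_
  congr 1
  ring

theorem mconj_zero_left {m n : ℕ} (A : Matrix (Fin m) (Fin m) V) :
    mconj (0 : Matrix (Fin m) (Fin n) ℂ) A = 0 := by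
  ext i j
  simp [mconj]

/-- `mconj γ` as a linear map. -/
noncomputable def mconjLinear {m n : ℕ} (γ : Matrix (Fin m) (Fin n) ℂ) :
    Matrix (Fin m) (Fin m) V →ₗ[ℂ] Matrix (Fin n) (Fin n) V where
  toFun := mconj γ
  map_add' A B := by
    ext i j
    simp [mconj, Finset.sum_add_distrib]
  map_smul' c A := by
    ext i j
    simp only [mconj, Matrix.of_apply, Matrix.smul_apply, Finset.smul_sum, RingHom.id_apply]
    refine Finset.sum_congr rfl fun k _ => Finset.sum_congr rfl fun l _ => ?_
    rw [smul_comm]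

theorem continuous_mconj [TopologicalSpace V] [ContinuousAdd V] [ContinuousConstSMul ℂ V]
    {m n : ℕ} (γ : Matrix (Fin m) (Fin n) ℂ) :
    Continuous (mconj γ : Matrix (Fin m) (Fin m) V → Matrix (Fin n) (Fin n) V) := by
  refine continuous_matrix fun i j => ?_
  simp only [mconj, Matrix.of_apply]
  exact continuous_finsetSum _ fun k _ => continuous_finsetSum _ fun l _ =>
    (continuous_id.matrix_elem k l).const_smul _

end MatrixConjugation

theorem IsMatrixConvex.mconj_mem {V : Type*} [AddCommGroup V] [Module ℂ V]
    {K : ∀ n : ℕ, Set (Matrix (Fin n) (Fin n) V)} (hK : IsMatrixConvex K) {m n : ℕ}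
    (hm : 0 < m) (hn : 0 < n) {A : Matrix (Fin m) (Fin m) V} (hA : A ∈ K m)
    {γ : Matrix (Fin m) (Fin n) ℂ} (hγ : γᴴ * γ = 1) : mconj γ A ∈ K n := by
  simpa using hK 1 n one_pos hn (fun _ => m) (fun _ => A) (fun _ => γ) (fun _ => hm)
    (fun _ => hA) (by simpa using hγ)

theorem reM_isHermitian {ι : Type*} (X : Matrix ι ι ℂ) : (reM X).IsHermitian := by
  simp [Matrix.IsHermitian, reM, Matrix.conjTranspose_smul, add_comm]

theorem reM_sub {ι : Type*} (X Y : Matrix ι ι ℂ) : reM (X - Y) = reM X - reM Y := by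
  simp only [reM, Matrix.conjTranspose_sub, ← smul_sub]
  congr 1
  abel

theorem reM_kronecker_one {ι κ : Type*} [DecidableEq κ] (X : Matrix ι ι ℂ) :
    reM (X ⊗ₖ (1 : Matrix κ κ ℂ)) = reM X ⊗ₖ (1 : Matrix κ κ ℂ) := by
  simp [reM, Matrix.conjTranspose_kronecker, Matrix.add_kronecker, Matrix.smul_kronecker]

theorem star_dotProduct_reM_mulVec {ι : Type*} [Fintype ι] (X : Matrix ι ι ℂ) (x : ι → ℂ) :
    star x ⬝ᵥ (reM X *ᵥ x) = ((star x ⬝ᵥ (X *ᵥ x)).re : ℂ) := by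
  have h : star x ⬝ᵥ (Xᴴ *ᵥ x) = star (star x ⬝ᵥ (X *ᵥ x)) := by
    rw [← Matrix.star_dotProduct, Matrix.star_mulVec, Matrix.dotProduct_mulVec]
  simp only [reM, Matrix.smul_mulVec, Matrix.add_mulVec, dotProduct_smul, dotProduct_add, h]
  apply Complex.ext <;> simp
  ring

theorem star_dotProduct_amplify_mulVec {V : Type*} [AddCommGroup V] [Module ℂ V] {r k : ℕ}
    (L : Matrix (Fin r) (Fin r) V →ₗ[ℂ] ℂ)
    (B : Matrix (Fin k) (Fin k) V) (x : Fin r × Fin k → ℂ) :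
    star x ⬝ᵥ (amplify (fun v => Matrix.of fun i j => L (Matrix.single i j v)) B *ᵥ x) =
      L (mconj (Matrix.of fun s i => x (i, s)) B) := by
  rw [Matrix.matrix_eq_sum_single (mconj (Matrix.of fun s i => x (i, s)) B)]
  simp only [map_sum, dotProduct, Matrix.mulVec, amplify, mconj, Matrix.of_apply,
    Fintype.sum_prod_type, Finset.mul_sum, Pi.star_apply]
  have key : ∀ (i j : Fin r), L (Matrix.single i j
      (∑ s, ∑ t, (star (x (i, s)) * x (j, t)) • B s t)) =
      ∑ s, ∑ t, star (x (i, s)) * (L (Matrix.single i j (B s t)) * x (j, t)) := by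
    intro i j
    calc L (Matrix.single i j (∑ s, ∑ t, (star (x (i, s)) * x (j, t)) • B s t))
        = (L ∘ₗ Matrix.singleLinearMap ℂ i j)
            (∑ s, ∑ t, (star (x (i, s)) * x (j, t)) • B s t) := rfl
      _ = _ := by
        simp only [map_sum, map_smul, smul_eq_mul]
        refine Finset.sum_congr rfl fun s _ => Finset.sum_congr rfl fun t _ => ?_
        simp only [LinearMap.comp_apply, Matrix.singleLinearMap_apply]
        ring
  simp only [key]
  refine Finset.sum_congr rfl fun i _ => ?_
  rw [Finset.sum_comm]

theorem star_dotProduct_kronecker_one_mulVec {r k : ℕ}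
    (H : Matrix (Fin r) (Fin r) ℂ →ₗ[ℂ] ℂ) (x : Fin r × Fin k → ℂ) :
    star x ⬝ᵥ (((Matrix.of fun i j => H (Matrix.single i j 1)) ⊗ₖ
      (1 : Matrix (Fin k) (Fin k) ℂ)) *ᵥ x) =
      H ((Matrix.of fun s i => x (i, s))ᴴ * (Matrix.of fun s i => x (i, s))) := by
  rw [show (Matrix.of fun i j => H (Matrix.single i j 1)) ⊗ₖ (1 : Matrix (Fin k) (Fin k) ℂ) =
    amplify (fun v => Matrix.of fun i j => H (Matrix.single i j v)) 1 from ?_,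
    star_dotProduct_amplify_mulVec]
  · congr 1
    ext i j
    simp [mconj, Matrix.mul_apply, Matrix.one_apply]
  · ext ⟨i, s⟩ ⟨j, t⟩
    by_cases h : s = t <;> simp [amplify, h, Matrix.one_apply]

theorem star_inv_sqrt_mul_self {t : ℝ} (ht : 0 ≤ t) :
    star (((√t)⁻¹ : ℝ) : ℂ) * (((√t)⁻¹ : ℝ) : ℂ) = ((t⁻¹ : ℝ) : ℂ) := by
  rw [Complex.star_def, Complex.conj_ofReal, ← Complex.ofReal_mul, ← mul_inv,
    Real.mul_self_sqrt ht]

theorem exists_inv_trace_smul_mem_GammaSet {V : Type*} [AddCommGroup V] [Module ℂ V]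
    {K : ∀ n : ℕ, Set (Matrix (Fin n) (Fin n) V)} {k n : ℕ} (hk : 0 < k)
    {B : Matrix (Fin k) (Fin k) V} (hB : B ∈ K k) {ξ : Matrix (Fin k) (Fin n) ℂ} (hξ : ξ ≠ 0) :
    ∃ t : ℝ, 0 < t ∧ (ξᴴ * ξ).trace = t ∧
      (((t⁻¹ : ℝ) : ℂ) • (ξᴴ * ξ), ((t⁻¹ : ℝ) : ℂ) • mconj ξ B) ∈ GammaSet K n := by
  have h0 : 0 ≤ (ξᴴ * ξ).trace := (Matrix.posSemidef_conjTranspose_mul_self ξ).trace_nonneg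
  have hne : (ξᴴ * ξ).trace ≠ 0 := by rwa [Ne, Matrix.trace_conjTranspose_mul_self_eq_zero_iff]
  obtain ⟨h1, h2⟩ := Complex.le_def.mp h0
  have htr : (ξᴴ * ξ).trace = ((ξᴴ * ξ).trace.re : ℂ) :=
    Complex.ext (by simp) (by simpa using h2.symm)
  have ht : 0 < (ξᴴ * ξ).trace.re :=
    lt_of_le_of_ne (by simpa using h1) fun h => hne (by rw [htr, ← h]; simp)
  set t := (ξᴴ * ξ).trace.re
  have hc := star_inv_sqrt_mul_self ht.le
  have hs : ((((√t)⁻¹ : ℝ) : ℂ) • ξ)ᴴ * ((((√t)⁻¹ : ℝ) : ℂ) • ξ) =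
      ((t⁻¹ : ℝ) : ℂ) • (ξᴴ * ξ) := by
    rw [Matrix.conjTranspose_smul, Matrix.smul_mul, Matrix.mul_smul, smul_smul, hc]
  refine ⟨t, ht, htr, k, hk, B, (((√t)⁻¹ : ℝ) : ℂ) • ξ, hB, ?_, ?_⟩
  · rw [hs, Matrix.trace_smul, htr, smul_eq_mul, ← Complex.ofReal_mul, inv_mul_cancel₀ ht.ne',
      Complex.ofReal_one]
  · rw [hs, mconj_smul, hc]

/-- A functional exposing `x` in `Γ_n(K)` is dominated by the trace on the cone over `Γ_n(K)`,
with equality only on the ray through `x`. -/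
theorem re_le_of_exposes {V : Type*} [AddCommGroup V] [Module ℂ V]
    {K : ∀ n : ℕ, Set (Matrix (Fin n) (Fin n) V)} {n : ℕ}
    {x : Matrix (Fin n) (Fin n) ℂ × Matrix (Fin n) (Fin n) V}
    (φ : Matrix (Fin n) (Fin n) ℂ × Matrix (Fin n) (Fin n) V →ₗ[ℂ] ℂ) {a : ℝ}
    (hx : (φ x).re = a) (hφ : ∀ y ∈ GammaSet K n, y ≠ x → (φ y).re < a)
    {k : ℕ} (hk : 0 < k) {B : Matrix (Fin k) (Fin k) V} (hB : B ∈ K k)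
    (ξ : Matrix (Fin k) (Fin n) ℂ) :
    0 ≤ (a * (ξᴴ * ξ).trace - φ (ξᴴ * ξ, mconj ξ B)).re ∧
    ((a * (ξᴴ * ξ).trace - φ (ξᴴ * ξ, mconj ξ B)).re = 0 → ξ ≠ 0 →
      ∃ t : ℝ, 0 < t ∧ ξᴴ * ξ = (t : ℂ) • x.1 ∧ mconj ξ B = (t : ℂ) • x.2) := by
  by_cases hξ : ξ = 0
  · subst hξ
    refine ⟨?_, fun _ h => absurd rfl h⟩
    simp [mconj_zero_left, ← Prod.zero_eq_mk]
  obtain ⟨t, ht, htr, hmem⟩ := exists_inv_trace_smul_mem_GammaSet hk hB hξ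
  have hval : (φ (ξᴴ * ξ, mconj ξ B)).re =
      t * (φ (((t⁻¹ : ℝ) : ℂ) • (ξᴴ * ξ), ((t⁻¹ : ℝ) : ℂ) • mconj ξ B)).re := by
    rw [← Prod.smul_mk, map_smul, smul_eq_mul, Complex.re_ofReal_mul, mul_inv_cancel_left₀ ht.ne']
  have hgap : (a * (ξᴴ * ξ).trace - φ (ξᴴ * ξ, mconj ξ B)).re =
      t * (a - (φ (((t⁻¹ : ℝ) : ℂ) • (ξᴴ * ξ), ((t⁻¹ : ℝ) : ℂ) • mconj ξ B)).re) := by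
    rw [Complex.sub_re, hval, htr, ← Complex.ofReal_mul, Complex.ofReal_re]
    ring
  rw [hgap]
  by_cases hy : (((t⁻¹ : ℝ) : ℂ) • (ξᴴ * ξ), ((t⁻¹ : ℝ) : ℂ) • mconj ξ B) = x
  · refine ⟨by rw [hy, hx, sub_self, mul_zero], fun _ _ => ⟨t, ht, ?_, ?_⟩⟩ <;>
      simp [← hy, smul_smul, ht.ne']
  · have hpos := mul_pos ht (sub_pos.mpr (hφ _ hmem hy))
    exact ⟨hpos.le, fun h => absurd h hpos.ne'⟩

theorem isMatrixExposed_of_isExposedPoint_GammaSet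
    {V : Type*} [AddCommGroup V] [Module ℂ V] [TopologicalSpace V] [ContinuousAdd V]
    [ContinuousConstSMul ℂ V]
    {K : ∀ n : ℕ, Set (Matrix (Fin n) (Fin n) V)} (hK : IsMatrixConvex K)
    {r n : ℕ} (hr : 0 < r) {A : Matrix (Fin r) (Fin r) V} (hA : A ∈ K r)
    {γ : Matrix (Fin r) (Fin n) ℂ} (hγ : Function.Surjective γ.mulVec)
    (htr : (γᴴ * γ).trace = 1) (hexp : IsExposedPoint (GammaSet K n) (γᴴ * γ, mconj γ A)) :
    IsMatrixExposed K A := by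
  obtain ⟨-, φ, a, hφx, hφ⟩ := hexp
  obtain ⟨R, hR⟩ := Matrix.mulVec_surjective_iff_exists_right_inverse.mp hγ
  have hR' : Rᴴ * γᴴ = 1 := by rw [← Matrix.conjTranspose_mul, hR, Matrix.conjTranspose_one]
  let gram : Matrix (Fin r) (Fin r) ℂ →ₗ[ℂ] Matrix (Fin n) (Fin n) ℂ := mconjLinear γ
  have hgram : ∀ P, gram P = γᴴ * P * γ := fun P => by
    ext i j
    simp only [gram, mconjLinear, LinearMap.coe_mk, AddHom.coe_mk, mconj, Matrix.of_apply,
      Matrix.mul_apply, Matrix.conjTranspose_apply, Finset.sum_mul, smul_eq_mul]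
    rw [Finset.sum_comm]
    refine Finset.sum_congr rfl fun s _ => Finset.sum_congr rfl fun t _ => ?_
    ring
  let H : Matrix (Fin r) (Fin r) ℂ →ₗ[ℂ] ℂ :=
    ((a : ℂ) • Matrix.traceLinearMap (Fin n) ℂ ℂ -
      φ.toLinearMap ∘ₗ LinearMap.inl ℂ _ (Matrix (Fin n) (Fin n) V)) ∘ₗ gram
  let L : Matrix (Fin r) (Fin r) V →ₗ[ℂ] ℂ :=
    φ.toLinearMap ∘ₗ LinearMap.inr ℂ (Matrix (Fin n) (Fin n) ℂ) _ ∘ₗ mconjLinear γ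
  let Φ : V →L[ℂ] Matrix (Fin r) (Fin r) ℂ :=
    { toFun := fun v => Matrix.of fun i j => L (Matrix.single i j v)
      map_add' := fun v w => by
        ext i j
        simp [Matrix.single_add]
      map_smul' := fun c v => by
        ext i j
        simp [← Matrix.smul_single]
      cont := by
        refine continuous_matrix fun i j => φ.continuous.comp (continuous_const.prodMk
          ((continuous_mconj γ).comp (continuous_matrix fun s t => ?_)))
        by_cases h : i = s ∧ j = t
        · obtain ⟨rfl, rfl⟩ := h
          simpa using continuous_id'
        · simpa [Matrix.single, h] using continuous_const }
  let h : Matrix (Fin r) (Fin r) ℂ := Matrix.of fun i j => H (Matrix.single i j 1)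
  have hM : ∀ {k : ℕ} (B : Matrix (Fin k) (Fin k) V),
      reM h ⊗ₖ (1 : Matrix (Fin k) (Fin k) ℂ) - reM (amplify Φ B) =
        reM (h ⊗ₖ (1 : Matrix (Fin k) (Fin k) ℂ) - amplify Φ B) := fun B => by
    rw [reM_sub, reM_kronecker_one]
  have hform : ∀ {k : ℕ} (B : Matrix (Fin k) (Fin k) V) (X : Matrix (Fin k) (Fin r) ℂ),
      star (fun p : Fin r × Fin k => X p.2 p.1) ⬝ᵥ
        ((reM h ⊗ₖ (1 : Matrix (Fin k) (Fin k) ℂ) - reM (amplify Φ B)) *ᵥ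
          fun p : Fin r × Fin k => X p.2 p.1) =
        ((a * ((X * γ)ᴴ * (X * γ)).trace - φ ((X * γ)ᴴ * (X * γ), mconj (X * γ) B)).re : ℂ) := by
    intro k B X
    rw [hM, star_dotProduct_reM_mulVec, Matrix.sub_mulVec, dotProduct_sub,
      star_dotProduct_kronecker_one_mulVec]
    have h1 := star_dotProduct_amplify_mulVec L B fun p : Fin r × Fin k => X p.2 p.1
    change star (fun p : Fin r × Fin k => X p.2 p.1) ⬝ᵥ (amplify Φ B *ᵥ _) = _ at h1
    rw [h1]
    have h2 : H (Xᴴ * X) - L (mconj X B) =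
        a * ((X * γ)ᴴ * (X * γ)).trace - φ ((X * γ)ᴴ * (X * γ), mconj (X * γ) B) := by
      have hg : gram (Xᴴ * X) = (X * γ)ᴴ * (X * γ) := by
        rw [hgram, Matrix.conjTranspose_mul]
        simp only [Matrix.mul_assoc]
      have hs : φ ((X * γ)ᴴ * (X * γ), mconj (X * γ) B) =
          φ ((X * γ)ᴴ * (X * γ), 0) + φ (0, mconj (X * γ) B) := by
        rw [← map_add]
        simp
      rw [hs, ← mconj_mconj, ← hg]
      simp [H, L, mconjLinear, sub_sub]
    exact congrArg (fun z : ℂ => (z.re : ℂ)) h2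
  have hpsd : ∀ k : ℕ, 0 < k → ∀ B ∈ K k,
      (reM h ⊗ₖ (1 : Matrix (Fin k) (Fin k) ℂ) - reM (amplify Φ B)).PosSemidef := by
    intro k hk B hB
    refine Matrix.PosSemidef.of_dotProduct_mulVec_nonneg ?_ fun x => ?_
    · rw [hM]
      exact reM_isHermitian _
    · have hx := hform B (Matrix.of fun s i => x (i, s))
      have hx0 := (re_le_of_exposes φ.toLinearMap hφx hφ hk hB
        (Matrix.of (fun s i => x (i, s)) * γ)).1
      exact (Complex.zero_le_real.mpr hx0).trans_eq hx.symm
  refine ⟨Φ, reM h, reM_isHermitian h, hpsd, Set.ext fun B => ⟨?_, ?_⟩⟩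
  · rintro ⟨hB, -, hsing⟩
    rw [Matrix.isUnit_iff_isUnit_det, isUnit_iff_ne_zero, not_not,
      ← Matrix.exists_mulVec_eq_zero_iff] at hsing
    obtain ⟨x, hx0, hx⟩ := hsing
    set X : Matrix (Fin r) (Fin r) ℂ := Matrix.of fun s i => x (i, s) with hX
    have hX0 : X * γ ≠ 0 := fun hz => hx0 <| by
      have : X = 0 := by rw [← Matrix.mul_one X, ← hR, ← Matrix.mul_assoc, hz, Matrix.zero_mul]
      ext ⟨i, s⟩
      exact congrFun (congrFun this s) i
    have hq := hform B X
    change star x ⬝ᵥ (_ *ᵥ x) = _ at hq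
    rw [hx, dotProduct_zero] at hq
    obtain ⟨t, ht, ht1, ht2⟩ := (re_le_of_exposes φ.toLinearMap hφx hφ hr hB (X * γ)).2
      (Complex.ofReal_eq_zero.mp hq.symm) hX0
    have hXX : Xᴴ * X = (t : ℂ) • (1 : Matrix (Fin r) (Fin r) ℂ) := by
      calc Xᴴ * X = Rᴴ * γᴴ * Xᴴ * X * (γ * R) := by rw [hR, hR', Matrix.one_mul, Matrix.mul_one]
        _ = Rᴴ * ((X * γ)ᴴ * (X * γ)) * R := by
          simp only [Matrix.conjTranspose_mul, Matrix.mul_assoc]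
        _ = (t : ℂ) • ((Rᴴ * γᴴ) * (γ * R)) := by
          rw [ht1]
          simp only [Matrix.mul_smul, Matrix.smul_mul, Matrix.mul_assoc]
        _ = _ := by rw [hR, hR', Matrix.one_mul]
    have hXA : mconj X B = (t : ℂ) • A := by
      have := congrArg (mconj R) ht2
      rw [← mconj_mconj, mconj_mconj, hR, mconj_one] at this
      rw [this]
      change mconjLinear R _ = _
      rw [map_smul]
      change _ • mconj R (mconj γ A) = _
      rw [mconj_mconj, hR, mconj_one]
    have hc := star_inv_sqrt_mul_self ht.le
    have htt : ((t⁻¹ : ℝ) : ℂ) * (t : ℂ) = 1 := by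
      rw [← Complex.ofReal_mul, inv_mul_cancel₀ ht.ne', Complex.ofReal_one]
    set U : Matrix (Fin r) (Fin r) ℂ := (((√t)⁻¹ : ℝ) : ℂ) • X
    have hU : Uᴴ * U = 1 := by
      rw [Matrix.conjTranspose_smul, Matrix.smul_mul, Matrix.mul_smul, smul_smul, hc, hXX,
        smul_smul, htt, one_smul]
    have hU' : U * Uᴴ = 1 := mul_eq_one_comm.mp hU
    have hUA : mconj U B = A := by rw [mconj_smul, hc, hXA, smul_smul, htt, one_smul]
    refine ⟨Uᴴ, Matrix.mem_unitaryGroup_iff.mpr ?_, ?_⟩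
    · rw [Matrix.star_eq_conjTranspose, Matrix.conjTranspose_conjTranspose, hU]
    · rw [← hUA, mconj_mconj, hU', mconj_one]
  · rintro ⟨U, hU, rfl⟩
    have hU1 : Uᴴ * U = 1 := Matrix.mem_unitaryGroup_iff'.mp hU
    have hU2 : U * Uᴴ = 1 := Matrix.mem_unitaryGroup_iff.mp hU
    have hB : mconj U A ∈ K r := hK.mconj_mem hr hr hA hU1
    have hP := hpsd r hr _ hB
    refine ⟨hB, hP, ?_⟩
    rw [Matrix.isUnit_iff_isUnit_det, isUnit_iff_ne_zero, not_not,
      ← Matrix.exists_mulVec_eq_zero_iff]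
    refine ⟨fun p => Uᴴ p.2 p.1, fun hz => ?_, (hP.dotProduct_mulVec_zero_iff _).mp ?_⟩
    · have : Uᴴ = 0 := by
        ext s i
        exact congrFun hz (i, s)
      have hone := congrFun (congrFun hU2 ⟨0, hr⟩) ⟨0, hr⟩
      simp [this] at hone
    · have hUγ : U * (Uᴴ * γ) = γ := by rw [← Matrix.mul_assoc, hU2, Matrix.one_mul]
      have hgramU : (Uᴴ * γ)ᴴ * (Uᴴ * γ) = γᴴ * γ := by
        rw [Matrix.conjTranspose_mul, Matrix.conjTranspose_conjTranspose, Matrix.mul_assoc, hUγ]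
      rw [hform, hgramU, mconj_mconj, hUγ, htr, mul_one, Complex.sub_re, Complex.ofReal_re, hφx,
        sub_self, Complex.ofReal_zero]

section Statements

variable {E F' : Type*} [AddCommGroup E] [Module ℂ E] [AddCommGroup F'] [Module ℂ F']
theorem gamma_exposed_implies_matrixExposed
    (p : E →ₗ[ℂ] F' →ₗ[ℂ] ℂ)
    (K : ∀ n : ℕ, Set (Matrix (Fin n) (Fin n) (WeakBilin p)))
    (hK : IsMatrixConvex K)
    (h0 : (0 : Matrix (Fin 1) (Fin 1) (WeakBilin p)) ∈ K 1)
    (hnz : ∃ w ∈ K 1, w ≠ 0)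
    (r n : ℕ) (hr : 0 < r) (hn : 0 < n)
    (A : Matrix (Fin r) (Fin r) (WeakBilin p)) (hA : A ∈ K r)
    (γ : Matrix (Fin r) (Fin n) ℂ) (hγ : Function.Surjective γ.mulVec)
    (htr : (γᴴ * γ).trace = 1)
    (hexp : IsExposedPoint (GammaSet K n) (γᴴ * γ, mconj γ A)) :
    IsMatrixExposed K A := by
  exact isMatrixExposed_of_isExposedPoint_GammaSet hK hr hA hγ htr hexp

end Statements
end
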